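/- For every real number k with 0 ≤ k < 1/2, the series Σ_{n=1}^{∞} (1/n)·(4^{n−1} − binom(2n−1, n−1))·(k(1−k))ⁿ converges with sum log(1 − k) − (1/2)·log(1 − 2k). -/

import Mathlib

theorem aux_summable (a : ℕ → ℝ) (ha : ∀ n, |a n| ≤ 4 ^ n) {z : ℝ} (hz : |z| < 1 / 4) :
    Summable (fun n => a n * z ^ n) := by
  have h := summable_geometric_of_lt_one (r := 4 * |z|) (by positivity) (by linarith)
  refine Summable.of_norm_bounded h fun n => ?_
  rw [Real.norm_eq_abs, abs_mul, abs_pow, mul_pow]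
  exact mul_le_mul_of_nonneg_right (ha n) (by positivity)

theorem aux_summable_bd {r : ℝ} (h0 : 0 ≤ r) (hr : r < 1 / 4) :
    Summable (fun n : ℕ => (4 : ℝ) ^ n * (n * r ^ (n - 1))) := by
  rw [← summable_nat_add_iff 1]
  have hn : ‖4 * r‖ < 1 := by
    rw [Real.norm_eq_abs, abs_of_nonneg (by positivity)]; linarith
  have h1 := (summable_pow_mul_geometric_of_norm_lt_one 1 hn).mul_left 4
  have h2 := (summable_pow_mul_geometric_of_norm_lt_one 0 hn).mul_left 4
  refine (h1.add h2).congr fun n => ?_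
  simp only [Nat.add_sub_cancel, mul_pow]
  push_cast
  ring

theorem aux_summable' (a : ℕ → ℝ) (ha : ∀ n, |a n| ≤ 4 ^ n) {z : ℝ} (hz : |z| < 1 / 4) :
    Summable (fun n : ℕ => a n * (n * z ^ (n - 1))) := by
  refine Summable.of_norm_bounded (aux_summable_bd (abs_nonneg z) hz) fun n => ?_
  rw [Real.norm_eq_abs, abs_mul, abs_mul, abs_pow, Nat.abs_cast]
  exact mul_le_mul_of_nonneg_right (ha n) (by positivity)

theorem aux_deriv (a : ℕ → ℝ) (ha : ∀ n, |a n| ≤ 4 ^ n) {z : ℝ} (hz : |z| < 1 / 4) :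
    HasDerivAt (fun z => ∑' n, a n * z ^ n) (∑' n : ℕ, a n * (n * z ^ (n - 1))) z := by
  obtain ⟨r, hr1, hr2⟩ := exists_between hz
  have hr0 : 0 < r := (abs_nonneg z).trans_lt hr1
  refine hasDerivAt_tsum_of_isPreconnected (t := Metric.ball 0 r) (y₀ := z)
    (g := fun n z => a n * z ^ n) (g' := fun n z => a n * (n * z ^ (n - 1)))
    (aux_summable_bd hr0.le hr2) Metric.isOpen_ball
    (convex_ball 0 r).isPreconnected ?_ ?_ ?_ (aux_summable a ha hz) ?_
  · intro n y _
    exact (hasDerivAt_pow n y).const_mul (a n)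
  · intro n y hy
    have hy' : |y| ≤ r := by simpa using (Metric.mem_ball.1 hy).le
    rw [Real.norm_eq_abs, abs_mul, abs_mul, abs_pow, Nat.abs_cast]
    gcongr
    exact ha n
  · simpa using hr1
  · simpa using hr1

theorem cb_bd (n : ℕ) : |(n.centralBinom : ℝ)| ≤ 4 ^ n := by
  rw [Nat.abs_cast]; exact_mod_cast n.centralBinom_le_four_pow

theorem cb_bd' (n : ℕ) : |(n.centralBinom : ℝ) / (2 * n)| ≤ 4 ^ n := by
  rcases Nat.eq_zero_or_pos n with rfl | hn
  · simp
  · rw [abs_div]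
    refine le_trans (div_le_self (abs_nonneg _) ?_) (cb_bd n)
    have : (1 : ℝ) ≤ n := by exact_mod_cast hn
    rw [abs_of_nonneg (by positivity)]; linarith

theorem g_ode {z : ℝ} (hz : |z| < 1 / 4) :
    (1 - 4 * z) * (∑' n : ℕ, (n.centralBinom : ℝ) * (n * z ^ (n - 1)))
      = 2 * ∑' n : ℕ, (n.centralBinom : ℝ) * z ^ n := by
  have hs := aux_summable' (fun n => (n.centralBinom : ℝ)) cb_bd hz
  have hg := aux_summable (fun n => (n.centralBinom : ℝ)) cb_bd hz
  have e1 := hs.tsum_eq_zero_add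
  have hs1 := (summable_nat_add_iff 1).2 hs
  simp only [Nat.cast_zero, zero_mul, mul_zero, zero_add, Nat.add_sub_cancel] at e1 hs1
  have key : ∀ n : ℕ, ((n + 1).centralBinom : ℝ) * (((n + 1 : ℕ) : ℝ) * z ^ n)
      = 4 * z * ((n.centralBinom : ℝ) * (n * z ^ (n - 1)))
        + 2 * ((n.centralBinom : ℝ) * z ^ n) := by
    intro n
    have h : ((n : ℝ) + 1) * ((n + 1).centralBinom : ℝ) = 2 * (2 * n + 1) * n.centralBinom := by
      exact_mod_cast n.succ_mul_centralBinom_succ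
    have hp : (n : ℝ) * z ^ n = n * (z * z ^ (n - 1)) := by
      cases n with
      | zero => simp
      | succ m => rw [Nat.add_sub_cancel, pow_succ']
    push_cast
    linear_combination z ^ n * h + 4 * (n.centralBinom : ℝ) * hp
  have e2 : (∑' n : ℕ, (n.centralBinom : ℝ) * (n * z ^ (n - 1)))
      = 4 * z * (∑' n : ℕ, (n.centralBinom : ℝ) * (n * z ^ (n - 1)))
        + 2 * ∑' n : ℕ, (n.centralBinom : ℝ) * z ^ n := by
    conv_lhs => rw [e1]
    rw [tsum_congr key, (hs.mul_left _).tsum_add (hg.mul_left _), tsum_mul_left, tsum_mul_left]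
  linarith

theorem z_bd {x : ℝ} (h0 : 0 ≤ x) (h1 : x < 1 / 2) : |x * (1 - x)| < 1 / 4 := by
  rw [abs_of_nonneg (mul_nonneg h0 (by linarith))]
  nlinarith [mul_pos (sub_pos.2 h1) (sub_pos.2 h1)]

theorem z_deriv (x : ℝ) : HasDerivAt (fun x : ℝ => x * (1 - x)) (1 - 2 * x) x := by
  have := (hasDerivAt_id x).mul ((hasDerivAt_id x).const_sub 1)
  refine this.congr_deriv ?_
  simp; ring

theorem g_val {k : ℝ} (h0 : 0 ≤ k) (h1 : k < 1 / 2) :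
    (1 - 2 * k) * (∑' n : ℕ, (n.centralBinom : ℝ) * (k * (1 - k)) ^ n) = 1 := by
  have hd : ∀ x ∈ Set.Icc 0 k, HasDerivAt
      (fun x : ℝ => (1 - 2 * x) * (∑' n : ℕ, (n.centralBinom : ℝ) * (x * (1 - x)) ^ n)) 0 x := by
    intro x hx
    have hz := z_bd hx.1 (hx.2.trans_lt h1)
    have hg := (aux_deriv (fun n => (n.centralBinom : ℝ)) cb_bd hz).comp x (z_deriv x)
    have hl : HasDerivAt (fun x : ℝ => 1 - 2 * x) (-2) x := by
      simpa using ((hasDerivAt_id x).const_mul 2).const_sub 1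
    refine (hl.mul hg).congr_deriv ?_
    have := g_ode hz
    simp only [Function.comp]
    linear_combination this
  have := constant_of_has_deriv_right_zero (fun x hx => (hd x hx).continuousAt.continuousWithinAt)
    (fun x hx => (hd x (Set.Ico_subset_Icc_self hx)).hasDerivWithinAt) k ⟨h0, le_rfl⟩
  rw [this, tsum_eq_single 0 (fun n hn => by simp [hn])]
  simp

theorem F_rel {z : ℝ} (hz : |z| < 1 / 4) :
    2 * z * (∑' n : ℕ, (n.centralBinom : ℝ) / (2 * n) * (n * z ^ (n - 1)))
      = (∑' n : ℕ, (n.centralBinom : ℝ) * z ^ n) - 1 := by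
  have hg := aux_summable (fun n => (n.centralBinom : ℝ)) cb_bd hz
  have hs := aux_summable' (fun n => (n.centralBinom : ℝ) / (2 * n)) cb_bd' hz
  rw [hg.tsum_eq_zero_add, hs.tsum_eq_zero_add]
  simp only [Nat.cast_zero, zero_mul, mul_zero, zero_add, Nat.add_sub_cancel,
    Nat.centralBinom_zero, pow_zero, Nat.cast_one, mul_one, add_sub_cancel_left]
  rw [← tsum_mul_left]
  refine tsum_congr fun n => ?_
  have : ((n + 1 : ℕ) : ℝ) ≠ 0 := by positivity
  field_simp
  ring

theorem F_val {k : ℝ} (h0 : 0 ≤ k) (h1 : k < 1 / 2) :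
    (∑' n : ℕ, (n.centralBinom : ℝ) / (2 * n) * (k * (1 - k)) ^ n) = - Real.log (1 - k) := by
  have hd : ∀ x ∈ Set.Icc 0 k, HasDerivAt
      (fun x : ℝ => (∑' n : ℕ, (n.centralBinom : ℝ) / (2 * n) * (x * (1 - x)) ^ n)
        + Real.log (1 - x)) 0 x := by
    intro x hx
    have hx2 := hx.2.trans_lt h1
    have hz := z_bd hx.1 hx2
    have hg := (aux_deriv (fun n => (n.centralBinom : ℝ) / (2 * n)) cb_bd' hz).comp x (z_deriv x)
    have hne : 1 - x ≠ 0 := by linarith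
    have hl : HasDerivAt (fun x : ℝ => Real.log (1 - x)) (-1 / (1 - x)) x := by
      simpa using ((hasDerivAt_id x).const_sub 1).log hne
    refine (hg.add hl).congr_deriv ?_
    rcases hx.1.eq_or_lt with rfl | hpos
    · rw [tsum_eq_single 1]
      · simp [Nat.centralBinom]
      · intro n hn
        rcases Nat.eq_zero_or_pos n with rfl | hp
        · simp
        · have : n - 1 ≠ 0 := by omega
          simp [this]
    · have e1 := F_rel hz
      have e2 := g_val hx.1 hx2
      set S := ∑' n : ℕ, (n.centralBinom : ℝ) / (2 * n) * (n * (x * (1 - x)) ^ (n - 1))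
      have : S * (1 - 2 * x) * (1 - x) = 1 := by
        apply mul_left_cancel₀ hpos.ne'
        linear_combination (1 - 2 * x) / 2 * e1 + e2 / 2
      field_simp
      linarith
  have := constant_of_has_deriv_right_zero (fun x hx => (hd x hx).continuousAt.continuousWithinAt)
    (fun x hx => (hd x (Set.Ico_subset_Icc_self hx)).hasDerivWithinAt) k ⟨h0, le_rfl⟩
  have e0 : (∑' n : ℕ, (n.centralBinom : ℝ) / (2 * n) * ((0:ℝ) * (1 - 0)) ^ n) = 0 := by
    rw [tsum_eq_single 0 (fun n hn => by simp [hn])]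
    simp
  rw [e0] at this
  simp at this
  linarith

/-- For every real `k` with `0 ≤ k < 1/2`:
`Σ_{n≥1} (1/n)·(4^{n−1} − C(2n−1, n−1))·(k(1−k))ⁿ = log(1−k) − (1/2)log(1−2k)`.
(The `n = 0` term vanishes since `1/0 = 0` in `ℝ`.) -/
theorem statement10 (k : ℝ) (hk0 : 0 ≤ k) (hk1 : k < 1 / 2) :
    HasSum (fun n : ℕ =>
        (1 / (n : ℝ)) * ((4 : ℝ) ^ (n - 1) - (Nat.choose (2 * n - 1) (n - 1) : ℝ)) *
          (k * (1 - k)) ^ n)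
      (Real.log (1 - k) - (1 / 2) * Real.log (1 - 2 * k)) := by
  have hz := z_bd hk0 hk1
  have hF : HasSum (fun n : ℕ => (n.centralBinom : ℝ) / (2 * n) * (k * (1 - k)) ^ n)
      (-Real.log (1 - k)) := by
    rw [← F_val hk0 hk1]
    exact (aux_summable (fun n => (n.centralBinom : ℝ) / (2 * n)) cb_bd' hz).hasSum
  have hL := Real.hasSum_pow_div_log_of_abs_lt_one (x := 4 * (k * (1 - k)))
    (by rw [abs_mul, abs_of_pos (by norm_num : (0:ℝ) < 4)]; linarith)
  have hsq : 1 - 4 * (k * (1 - k)) = (1 - 2 * k) ^ 2 := by ring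
  rw [hsq, Real.log_pow] at hL
  rw [← hasSum_nat_add_iff' 1] at hF ⊢
  convert (hL.mul_left (1 / 4)).sub hF using 1
  · funext n
    have hc : ((n + 1).centralBinom : ℝ) = 2 * ((2 * (n + 1) - 1).choose (n + 1 - 1) : ℕ) := by
      have : (n + 1).centralBinom = 2 * (2 * n + 1).choose n := by
        rw [Nat.centralBinom_eq_two_mul_choose, show 2 * (n + 1) = 2 * n + 1 + 1 by ring,
          Nat.choose_succ_succ, Nat.choose_symm_half]
        ring
      rw [this, show 2 * (n + 1) - 1 = 2 * n + 1 by omega, Nat.add_sub_cancel]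
      push_cast; ring
    rw [hc]
    have : ((n : ℝ) + 1) ≠ 0 := by positivity
    push_cast
    rw [mul_pow (4 : ℝ), pow_succ (4 : ℝ)]
    field_simp
  · simp
    ring
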